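/- arXiv:2304.07776 — 2 statements merged into one kernel-verified Lean document; each statement's English description precedes it below -/
import Mathlib

section
/- Let x₀ = val(i₁,…,i_{m-1}, i_m, 0, 0, 0, …) with i_m ≠ 0 be a P₃-rational point in (0,1). Then the one-sided limits of f at x₀ are lim_{x→x₀⁻} f(x) = val(θ(i₁),…,θ(i_{m-1}), θ(i_m−1), 1, 1, 1, …) and lim_{x→x₀⁺} f(x) = val(θ(i₁),…,θ(i_{m-1}), θ(i_m), 0, 0, 0, …), and these two values are distinct; hence f is discontinuous at every P₃-rational point of (0,1). -/
open Filter MeasureTheory Finset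

/-- The "beta" values `β₀ = 0`, `β₁ = p₀`, `β₂ = p₀ + p₁` associated with weights `p`. -/
noncomputable def P3beta (p : Fin 3 → ℝ) : Fin 3 → ℝ := ![0, p 0, p 0 + p 1]

/-- The P₃-value of a digit sequence `i : ℕ → Fin 3` (0-indexed):
`val(i) = β_{i₀} + Σ_{k≥1} β_{i_k} ∏_{r<k} p_{i_r}`. -/
noncomputable def P3val (p : Fin 3 → ℝ) (i : ℕ → Fin 3) : ℝ :=
  ∑' k : ℕ, P3beta p (i k) * ∏ r ∈ Finset.range k, p (i r)

/-- The digit permutation θ with θ(0)=0, θ(1)=2, θ(2)=1. -/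
def P3theta : Fin 3 → Fin 3 := ![0, 2, 1]

/-- The one-sided shift on digit sequences. -/
def P3shift (i : ℕ → Fin 3) : ℕ → Fin 3 := fun k => i (k + 1)

/-- The left endpoint of the cylinder of rank `n` containing the digit sequence `e`. -/
noncomputable def P3low (p : Fin 3 → ℝ) (e : ℕ → Fin 3) (n : ℕ) : ℝ :=
  ∑ k ∈ Finset.range n, P3beta p (e k) * ∏ r ∈ Finset.range k, p (e r)

/-- The length of the cylinder of rank `n` containing the digit sequence `e`. -/
noncomputable def P3len (p : Fin 3 → ℝ) (e : ℕ → Fin 3) (n : ℕ) : ℝ :=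
  ∏ r ∈ Finset.range n, p (e r)

section

variable {p : Fin 3 → ℝ}

lemma P3low_succ (e : ℕ → Fin 3) (n : ℕ) :
    P3low p e (n + 1) = P3low p e n + P3len p e n * P3beta p (e n) := by
  simp only [P3low, P3len, Finset.sum_range_succ]
  ring

lemma P3len_succ (e : ℕ → Fin 3) (n : ℕ) :
    P3len p e (n + 1) = P3len p e n * p (e n) := by
  simp only [P3len, Finset.prod_range_succ]

lemma P3low_congr {d e : ℕ → Fin 3} {n : ℕ} (h : ∀ k < n, d k = e k) :
    P3low p d n = P3low p e n := by
  refine Finset.sum_congr rfl fun k hk => ?_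
  have hk := Finset.mem_range.1 hk
  rw [h k hk, Finset.prod_congr rfl fun r hr => ?_]
  rw [h r ((Finset.mem_range.1 hr).trans hk)]

lemma P3len_congr {d e : ℕ → Fin 3} {n : ℕ} (h : ∀ k < n, d k = e k) :
    P3len p d n = P3len p e n :=
  Finset.prod_congr rfl fun r hr => by rw [h r (Finset.mem_range.1 hr)]

lemma P3len_pos (hp : ∀ t, p t ∈ Set.Ioo (0 : ℝ) 1) (e : ℕ → Fin 3) (n : ℕ) :
    0 < P3len p e n :=
  Finset.prod_pos fun _ _ => (hp _).1

lemma P3len_tendsto_zero (hp : ∀ t, p t ∈ Set.Ioo (0 : ℝ) 1) (e : ℕ → Fin 3) :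
    Tendsto (P3len p e) atTop (nhds 0) := by
  obtain ⟨t, ht⟩ := Finite.exists_max p
  refine squeeze_zero (fun n => (P3len_pos hp e n).le) (fun n => ?_)
    (tendsto_pow_atTop_nhds_zero_of_lt_one (hp t).1.le (hp t).2)
  calc P3len p e n ≤ ∏ _r ∈ Finset.range n, p t :=
        Finset.prod_le_prod (fun _ _ => (hp _).1.le) fun _ _ => ht _
    _ = p t ^ n := by simp

lemma P3beta_nonneg (hp : ∀ t, p t ∈ Set.Ioo (0 : ℝ) 1) (t : Fin 3) : 0 ≤ P3beta p t := by
  have h0 := (hp 0).1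
  have h1 := (hp 1).1
  fin_cases t <;> simp [P3beta] <;> linarith

lemma P3beta_add_le_one (hp : ∀ t, p t ∈ Set.Ioo (0 : ℝ) 1) (hsum : p 0 + p 1 + p 2 = 1)
    (t : Fin 3) : P3beta p t + p t ≤ 1 := by
  have h1 := (hp 1).1
  have h2 := (hp 2).1
  fin_cases t <;> simp [P3beta] <;> linarith

lemma P3beta_add_lt_one (hp : ∀ t, p t ∈ Set.Ioo (0 : ℝ) 1) (hsum : p 0 + p 1 + p 2 = 1)
    {t : Fin 3} (ht : t ≠ 2) : P3beta p t + p t < 1 := by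
  have h1 := (hp 1).1
  have h2 := (hp 2).1
  fin_cases t <;> simp [P3beta] at ht ⊢ <;> linarith

lemma P3beta_sub_one_add {t : Fin 3} (ht : t ≠ 0) :
    P3beta p (t - 1) + p (t - 1) = P3beta p t := by
  fin_cases t
  · simp at ht
  · simp [P3beta]
  · change P3beta p 1 + p 1 = P3beta p 2
    simp [P3beta]

/-- The half-open first-rank cylinders are pairwise disjoint. -/
lemma eq_of_P3beta_le_of_lt (hp : ∀ t, p t ∈ Set.Ioo (0 : ℝ) 1) {s t : Fin 3} {v : ℝ}
    (hs : P3beta p s ≤ v) (hs' : v < P3beta p s + p s)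
    (ht : P3beta p t ≤ v) (ht' : v < P3beta p t + p t) : s = t := by
  have h0 := (hp 0).1
  have h1 := (hp 1).1
  fin_cases s <;> fin_cases t <;> simp [P3beta] at hs hs' ht ht' ⊢ <;> linarith

lemma P3low_add_P3len_succ_le (hp : ∀ t, p t ∈ Set.Ioo (0 : ℝ) 1)
    (hsum : p 0 + p 1 + p 2 = 1) (e : ℕ → Fin 3) (n : ℕ) :
    P3low p e (n + 1) + P3len p e (n + 1) ≤ P3low p e n + P3len p e n := by
  rw [P3low_succ, P3len_succ]
  nlinarith [P3len_pos hp e n, P3beta_add_le_one hp hsum (e n)]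

lemma P3low_add_P3len_le_one (hp : ∀ t, p t ∈ Set.Ioo (0 : ℝ) 1)
    (hsum : p 0 + p 1 + p 2 = 1) (e : ℕ → Fin 3) (n : ℕ) :
    P3low p e n + P3len p e n ≤ 1 := by
  induction n with
  | zero => simp [P3low, P3len]
  | succ n ih => exact (P3low_add_P3len_succ_le hp hsum e n).trans ih

lemma P3term_nonneg (hp : ∀ t, p t ∈ Set.Ioo (0 : ℝ) 1) (e : ℕ → Fin 3) (k : ℕ) :
    0 ≤ P3beta p (e k) * ∏ r ∈ Finset.range k, p (e r) :=
  mul_nonneg (P3beta_nonneg hp _) (P3len_pos hp e k).le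

lemma P3low_le_one (hp : ∀ t, p t ∈ Set.Ioo (0 : ℝ) 1)
    (hsum : p 0 + p 1 + p 2 = 1) (e : ℕ → Fin 3) (n : ℕ) : P3low p e n ≤ 1 := by
  linarith [P3low_add_P3len_le_one hp hsum e n, P3len_pos hp e n]

lemma P3val_nonneg (hp : ∀ t, p t ∈ Set.Ioo (0 : ℝ) 1) (e : ℕ → Fin 3) : 0 ≤ P3val p e :=
  tsum_nonneg (P3term_nonneg hp e)

lemma P3val_le_one (hp : ∀ t, p t ∈ Set.Ioo (0 : ℝ) 1)
    (hsum : p 0 + p 1 + p 2 = 1) (e : ℕ → Fin 3) : P3val p e ≤ 1 :=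
  Real.tsum_le_of_sum_range_le (P3term_nonneg hp e) (P3low_le_one hp hsum e)

lemma P3val_eq_add_tail (hp : ∀ t, p t ∈ Set.Ioo (0 : ℝ) 1)
    (hsum : p 0 + p 1 + p 2 = 1) (e : ℕ → Fin 3) (n : ℕ) :
    P3val p e = P3low p e n + P3len p e n * P3val p (fun k => e (k + n)) := by
  have hs : Summable fun k => P3beta p (e k) * ∏ r ∈ Finset.range k, p (e r) :=
    summable_of_sum_range_le (P3term_nonneg hp e) (P3low_le_one hp hsum e)
  rw [P3val, ← hs.sum_add_tsum_nat_add n, P3low, P3val, ← tsum_mul_left]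
  congr 1
  refine tsum_congr fun k => ?_
  rw [add_comm k n, Finset.prod_range_add, P3len]
  simp only [add_comm n]
  ring

lemma P3val_of_tail_eq (hp : ∀ t, p t ∈ Set.Ioo (0 : ℝ) 1)
    (hsum : p 0 + p 1 + p 2 = 1) {e : ℕ → Fin 3} {n : ℕ} {c : Fin 3}
    (h : ∀ k, n ≤ k → e k = c) :
    P3val p e = P3low p e n + P3len p e n * P3val p (fun _ => c) := by
  rw [P3val_eq_add_tail hp hsum e n]
  simp only [h _ (Nat.le_add_left n _)]

lemma P3val_of_tail_eq_succ (hp : ∀ t, p t ∈ Set.Ioo (0 : ℝ) 1)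
    (hsum : p 0 + p 1 + p 2 = 1) {e : ℕ → Fin 3} {n : ℕ} {c : Fin 3}
    (h : ∀ k, n < k → e k = c) :
    P3val p e = P3low p e n +
      P3len p e n * (P3beta p (e n) + p (e n) * P3val p (fun _ => c)) := by
  rw [P3val_of_tail_eq hp hsum (n := n + 1) h, P3low_succ, P3len_succ]
  ring

lemma P3val_const_zero : P3val p (fun _ => 0) = 0 := by
  simp [P3val, P3beta]

lemma P3val_const_two (hp : ∀ t, p t ∈ Set.Ioo (0 : ℝ) 1)
    (hsum : p 0 + p 1 + p 2 = 1) : P3val p (fun _ => 2) = 1 := by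
  have h := P3val_of_tail_eq_succ hp hsum (e := fun _ => 2) (n := 0) fun _ _ => rfl
  have h2 := (hp 2).2
  simp [P3low, P3len, P3beta] at h
  have : (1 - p 2) * (P3val p (fun _ => 2) - 1) = 0 := by linear_combination h + hsum
  rcases mul_eq_zero.1 this with h' | h' <;> linarith

lemma P3val_lt_one (hp : ∀ t, p t ∈ Set.Ioo (0 : ℝ) 1)
    (hsum : p 0 + p 1 + p 2 = 1) {e : ℕ → Fin 3} {n : ℕ} (hn : e n ≠ 2) :
    P3val p e < 1 := by
  have h := P3val_eq_add_tail hp hsum e (n + 1)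
  rw [P3low_succ, P3len_succ] at h
  have hl := P3len_pos hp e n
  have h1 := mul_le_mul_of_nonneg_left (P3val_le_one hp hsum fun k => e (k + (n + 1)))
    (mul_pos hl (hp (e n)).1).le
  have h2 := mul_lt_mul_of_pos_left (P3beta_add_lt_one hp hsum hn) hl
  linarith [P3low_add_P3len_le_one hp hsum e n]

/-- A digit sequence not eventually `2` whose value lies in a half-open cylinder starts with
the digits of that cylinder. -/
lemma P3digit_eq_of_mem_cylinder (hp : ∀ t, p t ∈ Set.Ioo (0 : ℝ) 1)
    (hsum : p 0 + p 1 + p 2 = 1) {d : ℕ → Fin 3} (hd : ¬ ∃ N, ∀ k ≥ N, d k = 2)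
    (e : ℕ → Fin 3) (n : ℕ) (hlow : P3low p e n ≤ P3val p d)
    (hup : P3val p d < P3low p e n + P3len p e n) : ∀ k < n, d k = e k := by
  induction n with
  | zero => simp
  | succ n ih =>
    have hl := P3len_pos hp e n
    have hagree : ∀ k < n, d k = e k := by
      refine ih ?_ (hup.trans_le (P3low_add_P3len_succ_le hp hsum e n))
      rw [P3low_succ] at hlow
      linarith [mul_nonneg hl.le (P3beta_nonneg hp (e n))]
    have hval := P3val_eq_add_tail hp hsum d (n + 1)
    rw [P3low_succ, P3len_succ, P3low_congr hagree, P3len_congr hagree] at hval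
    rw [P3low_succ] at hlow hup
    rw [P3len_succ] at hup
    set w := P3val p fun k => d (k + (n + 1)) with hw
    have hw0 : 0 ≤ w := P3val_nonneg hp _
    have hw1 : w < 1 := by
      push Not at hd
      obtain ⟨k, hk, hk2⟩ := hd (n + 1)
      refine P3val_lt_one hp hsum (n := k - (n + 1)) ?_
      rwa [Nat.sub_add_cancel hk]
    have hpd := (hp (d n)).1
    have hdn : d n = e n := by
      refine eq_of_P3beta_le_of_lt hp (v := P3beta p (d n) + p (d n) * w) ?_ ?_ ?_ ?_
      · nlinarith
      · nlinarith
      · refine le_of_mul_le_mul_left ?_ hl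
        linarith
      · refine lt_of_mul_lt_mul_left ?_ hl.le
        linarith
    intro k hk
    rcases Nat.lt_succ_iff_lt_or_eq.1 hk with hk | rfl
    · exact hagree k hk
    · exact hdn

lemma abs_P3val_sub_le (hp : ∀ t, p t ∈ Set.Ioo (0 : ℝ) 1)
    (hsum : p 0 + p 1 + p 2 = 1) {d e : ℕ → Fin 3} {n : ℕ} (h : ∀ k < n, d k = e k) :
    |P3val p d - P3val p e| ≤ P3len p e n := by
  have hl := P3len_pos hp e n
  rw [P3val_eq_add_tail hp hsum d n, P3val_eq_add_tail hp hsum e n, P3low_congr h,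
    P3len_congr h, add_sub_add_left_eq_sub, ← mul_sub, abs_mul, abs_of_pos hl]
  refine mul_le_of_le_one_right hl.le (abs_sub_le_iff.2 ⟨?_, ?_⟩) <;>
  linarith [P3val_nonneg hp fun k => d (k + n), P3val_le_one hp hsum fun k => d (k + n),
    P3val_nonneg hp fun k => e (k + n), P3val_le_one hp hsum fun k => e (k + n)]

/-- If a filter eventually enters every sufficiently small half-open cylinder of `e`, then the
function applying `P3theta` digitwise tends along it to the value of `P3theta ∘ e`. -/
lemma tendsto_P3val_theta (hp : ∀ t, p t ∈ Set.Ioo (0 : ℝ) 1)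
    (hsum : p 0 + p 1 + p 2 = 1) {f : ℝ → ℝ}
    (hf : ∀ i : ℕ → Fin 3, (¬ ∃ N, ∀ k ≥ N, i k = 2) →
      f (P3val p i) = P3val p (fun k => P3theta (i k)))
    (hrep : ∀ x ∈ Set.Ico (0 : ℝ) 1, ∃ i : ℕ → Fin 3,
      (¬ ∃ N, ∀ k ≥ N, i k = 2) ∧ P3val p i = x)
    {l : Filter ℝ} (e : ℕ → Fin 3) (N : ℕ) (hl : ∀ᶠ x in l, x ∈ Set.Ico (0 : ℝ) 1)
    (hcyl : ∀ n ≥ N, ∀ᶠ x in l, x ∈ Set.Ico (P3low p e n) (P3low p e n + P3len p e n)) :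
    Tendsto f l (nhds (P3val p fun k => P3theta (e k))) := by
  rw [Metric.tendsto_nhds]
  intro ε hε
  obtain ⟨n, hnε, hnN⟩ := (((P3len_tendsto_zero hp fun k => P3theta (e k)).eventually_lt_const
    hε).and (eventually_ge_atTop N)).exists
  filter_upwards [hl, hcyl n hnN] with x hx hxn
  obtain ⟨d, hd, rfl⟩ := hrep x hx
  have hde := P3digit_eq_of_mem_cylinder hp hsum hd e n hxn.1 hxn.2
  rw [hf d hd, Real.dist_eq]
  exact (abs_P3val_sub_le hp hsum fun k hk => by rw [hde k hk]).trans_lt hnε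

end

theorem stmt8 (p : Fin 3 → ℝ) (hp : ∀ t, p t ∈ Set.Ioo (0 : ℝ) 1)
    (hsum : p 0 + p 1 + p 2 = 1)
    (f : ℝ → ℝ)
    (hf : ∀ i : ℕ → Fin 3, (¬ ∃ N, ∀ k ≥ N, i k = 2) →
      f (P3val p i) = P3val p (fun k => P3theta (i k)))
    (hrep : ∀ x ∈ Set.Ico (0 : ℝ) 1, ∃ i : ℕ → Fin 3,
      (¬ ∃ N, ∀ k ≥ N, i k = 2) ∧ P3val p i = x)
    (m : ℕ) (i : ℕ → Fin 3) (him : i m ≠ 0) (hit : ∀ k, m < k → i k = 0)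
    (x₀ L R : ℝ)
    (hx₀ : x₀ = P3val p i) (hx₀mem : x₀ ∈ Set.Ioo (0 : ℝ) 1)
    (hL : L = P3val p (fun k =>
      if k < m then P3theta (i k) else if k = m then P3theta (i m - 1) else 1))
    (hR : R = P3val p (fun k =>
      if k < m then P3theta (i k) else if k = m then P3theta (i m) else 0)) :
    Tendsto f (nhdsWithin x₀ (Set.Ico 0 x₀)) (nhds L) ∧
      Tendsto f (nhdsWithin x₀ (Set.Ioc x₀ 1)) (nhds R) ∧
      L ≠ R ∧ ¬ ContinuousWithinAt f (Set.Icc 0 1) x₀ := by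
  set e : ℕ → Fin 3 := fun k => if k < m then i k else if k = m then i m - 1 else 2 with he
  have he_lt : ∀ k < m, e k = i k := fun k hk => by simp [he, hk]
  have he_m : e m = i m - 1 := by simp [he]
  have he_gt : ∀ k, m < k → e k = 2 := fun k hk => by simp [he, hk.not_gt, hk.ne']
  have hLe : L = P3val p fun k => P3theta (e k) := by
    rw [hL]
    congr 1
    funext k
    rcases lt_trichotomy k m with hk | rfl | hk
    · simp [hk, he_lt k hk]
    · simp [he_m]
    · simp [hk.not_gt, hk.ne', he_gt k hk, P3theta]
  have hRi : R = P3val p fun k => P3theta (i k) := by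
    rw [hR]
    congr 1
    funext k
    rcases lt_trichotomy k m with hk | rfl | hk
    · simp [hk]
    · simp
    · simp [hk.not_gt, hk.ne', hit k hk, P3theta]
  have hxi : ∀ n ≥ m + 1, x₀ = P3low p i n := fun n hn => by
    rw [hx₀, P3val_of_tail_eq hp hsum (n := n) fun k hk => hit k (by omega), P3val_const_zero]
    ring
  have hxe_val : x₀ = P3val p e := by
    rw [hx₀, P3val_of_tail_eq_succ hp hsum hit, P3val_of_tail_eq_succ hp hsum he_gt,
      P3low_congr he_lt, P3len_congr he_lt, he_m, P3val_const_zero, P3val_const_two hp hsum,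
      mul_one, P3beta_sub_one_add him]
    ring
  have hxe : ∀ n ≥ m + 1, x₀ = P3low p e n + P3len p e n := fun n hn => by
    rw [hxe_val, P3val_of_tail_eq hp hsum (n := n) fun k hk => he_gt k (by omega),
      P3val_const_two hp hsum, mul_one]
  have hleft : Tendsto f (nhdsWithin x₀ (Set.Ico 0 x₀)) (nhds L) := by
    rw [hLe]
    refine tendsto_P3val_theta hp hsum hf hrep e (m + 1) ?_ fun n hn => ?_
    · filter_upwards [self_mem_nhdsWithin] with x hx
      exact ⟨hx.1, hx.2.trans hx₀mem.2⟩
    · have hlow : P3low p e n < x₀ := by linarith [hxe n hn, P3len_pos hp e n]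
      filter_upwards [self_mem_nhdsWithin, mem_nhdsWithin_of_mem_nhds (Ioi_mem_nhds hlow)]
        with x hx hx'
      exact ⟨hx'.le, hxe n hn ▸ hx.2⟩
  have hright : Tendsto f (nhdsWithin x₀ (Set.Ioc x₀ 1)) (nhds R) := by
    rw [hRi]
    refine tendsto_P3val_theta hp hsum hf hrep i (m + 1) ?_ fun n hn => ?_
    · filter_upwards [self_mem_nhdsWithin,
        mem_nhdsWithin_of_mem_nhds (Iio_mem_nhds hx₀mem.2)] with x hx hx'
      exact ⟨hx₀mem.1.le.trans hx.1.le, hx'⟩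
    · have hup : x₀ < P3low p i n + P3len p i n := by linarith [hxi n hn, P3len_pos hp i n]
      filter_upwards [self_mem_nhdsWithin, mem_nhdsWithin_of_mem_nhds (Iio_mem_nhds hup)]
        with x hx hx'
      exact ⟨hxi n hn ▸ hx.1.le, hx'⟩
  have hne : L ≠ R := by
    have hθi : ∀ k, m < k → P3theta (i k) = 0 := fun k hk => by simp [hit k hk, P3theta]
    have hθe : ∀ k, m < k → P3theta (e k) = 1 := fun k hk => by simp [he_gt k hk, P3theta]
    have hθ : ∀ k < m, P3theta (e k) = P3theta (i k) := fun k hk => by rw [he_lt k hk]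
    have hv0 := P3val_nonneg hp fun _ => 1
    have hv1 := P3val_le_one hp hsum fun _ => 1
    rw [hLe, hRi, P3val_of_tail_eq_succ hp hsum hθi, P3val_of_tail_eq_succ hp hsum hθe,
      P3low_congr hθ, P3len_congr hθ, he_m, P3val_const_zero, mul_zero, add_zero]
    intro h
    have h := mul_left_cancel₀ (P3len_pos hp _ m).ne' (add_left_cancel h)
    have h0 := (hp 0).1
    have h1 := (hp 1).1
    have h2 := (hp 2).1
    have him' : i m = 1 ∨ i m = 2 := by
      generalize i m = t at him
      fin_cases t <;> simp_all
    rcases him' with ht | ht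
    · rw [ht, sub_self] at h
      simp [P3theta, P3beta] at h
      nlinarith
    · rw [ht, show (2 : Fin 3) - 1 = 1 from rfl] at h
      simp [P3theta, P3beta] at h
      nlinarith
  refine ⟨hleft, hright, hne, fun hcont => hne ?_⟩
  have hbotl : (nhdsWithin x₀ (Set.Ico 0 x₀)).NeBot := by
    rw [nhdsWithin_Ico_eq_nhdsLT hx₀mem.1]
    infer_instance
  have hbotr : (nhdsWithin x₀ (Set.Ioc x₀ 1)).NeBot := by
    rw [nhdsWithin_Ioc_eq_nhdsGT hx₀mem.2]
    infer_instance
  have hl := hcont.mono_left (nhdsWithin_mono x₀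
    (Set.Ico_subset_Icc_self.trans (Set.Icc_subset_Icc_right hx₀mem.2.le)))
  have hr := hcont.mono_left (nhdsWithin_mono x₀
    (Set.Ioc_subset_Icc_self.trans (Set.Icc_subset_Icc_left hx₀mem.1.le)))
  exact (tendsto_nhds_unique hleft hl).trans (tendsto_nhds_unique hright hr).symm
end

section
/- The Lebesgue integral of f over [0,1] equals (p₁² + p₀p₁ + p₀p₂)/(1 − p₀² − 2p₁p₂), i.e., ∫_{[0,1]} f(x) dx = (p₁² + p₀p₁ + p₀p₂)/(1 − p₀² − 2p₁p₂). -/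
open Filter MeasureTheory Finset

section P3val

variable {p : Fin 3 → ℝ}

lemma P3beta_mem_Icc (hp : ∀ t, 0 < p t) (hsum : p 0 + p 1 + p 2 = 1) (t : Fin 3) :
    P3beta p t ∈ Set.Icc 0 (1 - p t) := by
  have h0 := hp 0
  have h1 := hp 1
  have h2 := hp 2
  fin_cases t <;> simp [P3beta] <;> (try constructor) <;> linarith

lemma P3val_term_nonneg (hp : ∀ t, 0 < p t) (hsum : p 0 + p 1 + p 2 = 1) (i : ℕ → Fin 3) (k : ℕ) :
    0 ≤ P3beta p (i k) * ∏ r ∈ Finset.range k, p (i r) :=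
  mul_nonneg (P3beta_mem_Icc hp hsum _).1 (Finset.prod_nonneg fun _ _ => (hp _).le)

lemma P3val_partial_sum_le (hp : ∀ t, 0 < p t) (hsum : p 0 + p 1 + p 2 = 1)
    (i : ℕ → Fin 3) (n : ℕ) :
    ∑ k ∈ Finset.range n, P3beta p (i k) * ∏ r ∈ Finset.range k, p (i r) ≤
      1 - ∏ r ∈ Finset.range n, p (i r) := by
  induction n with
  | zero => simp
  | succ n ih =>
    rw [Finset.sum_range_succ, Finset.prod_range_succ]
    have hprod : 0 ≤ ∏ r ∈ Finset.range n, p (i r) := Finset.prod_nonneg fun _ _ => (hp _).le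
    nlinarith [mul_le_mul_of_nonneg_right (P3beta_mem_Icc hp hsum (i n)).2 hprod]

lemma P3val_partial_sum_le_one (hp : ∀ t, 0 < p t) (hsum : p 0 + p 1 + p 2 = 1)
    (i : ℕ → Fin 3) (n : ℕ) :
    ∑ k ∈ Finset.range n, P3beta p (i k) * ∏ r ∈ Finset.range k, p (i r) ≤ 1 :=
  (P3val_partial_sum_le hp hsum i n).trans
    (sub_le_self _ (Finset.prod_nonneg fun _ _ => (hp _).le))

lemma P3val_summable (hp : ∀ t, 0 < p t) (hsum : p 0 + p 1 + p 2 = 1) (i : ℕ → Fin 3) :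
    Summable fun k => P3beta p (i k) * ∏ r ∈ Finset.range k, p (i r) :=
  summable_of_sum_range_le (P3val_term_nonneg hp hsum i) (P3val_partial_sum_le_one hp hsum i)

lemma P3val_mem_Icc (hp : ∀ t, 0 < p t) (hsum : p 0 + p 1 + p 2 = 1) (i : ℕ → Fin 3) :
    P3val p i ∈ Set.Icc 0 1 :=
  ⟨tsum_nonneg (P3val_term_nonneg hp hsum i),
    Real.tsum_le_of_sum_range_le (P3val_term_nonneg hp hsum i)
      (P3val_partial_sum_le_one hp hsum i)⟩

lemma P3val_eq_add_shift (hp : ∀ t, 0 < p t) (hsum : p 0 + p 1 + p 2 = 1) (i : ℕ → Fin 3) :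
    P3val p i = P3beta p (i 0) + p (i 0) * P3val p (P3shift i) := by
  rw [P3val, (P3val_summable hp hsum i).tsum_eq_zero_add, P3val, ← tsum_mul_left]
  simp only [Finset.range_zero, Finset.prod_empty, mul_one, P3shift, Finset.prod_range_succ']
  congr 1
  exact tsum_congr fun k => by ring

/-- The functional equation of the digit-permuting function on each first-level cylinder. -/
lemma P3_digit_map_self_similar (hp : ∀ t, 0 < p t) (hsum : p 0 + p 1 + p 2 = 1) {f : ℝ → ℝ}
    (hf : ∀ i : ℕ → Fin 3, (¬ ∃ N, ∀ k ≥ N, i k = 2) →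
      f (P3val p i) = P3val p (fun k => P3theta (i k)))
    (hrep : ∀ x ∈ Set.Ico (0 : ℝ) 1, ∃ i : ℕ → Fin 3,
      (¬ ∃ N, ∀ k ≥ N, i k = 2) ∧ P3val p i = x)
    (t : Fin 3) {x : ℝ} (hx : x ∈ Set.Ico (0 : ℝ) 1) :
    f (P3beta p t + p t * x) = P3beta p (P3theta t) + p (P3theta t) * f x := by
  obtain ⟨i, hi, rfl⟩ := hrep x hx
  let j : ℕ → Fin 3 := fun k => Nat.casesOn k t i
  have hj : ¬ ∃ N, ∀ k ≥ N, j k = 2 := fun ⟨N, hN⟩ =>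
    hi ⟨N, fun k hk => hN (k + 1) (by omega)⟩
  have hval : P3val p j = P3beta p t + p t * P3val p i := P3val_eq_add_shift hp hsum j
  rw [← hval, hf j hj, hf i hi]
  exact P3val_eq_add_shift hp hsum fun k => P3theta (j k)

/-- The affine iteration operator whose fixed point on `[0, 1)` is the digit-permuting function. -/
noncomputable def P3step (p : Fin 3 → ℝ) (g : ℝ → ℝ) (x : ℝ) : ℝ :=
  if x < p 0 then p 0 * g (x / p 0)
  else if x < p 0 + p 1 then p 0 + p 1 + p 2 * g ((x - p 0) / p 1)
  else p 0 + p 1 * g ((x - (p 0 + p 1)) / p 2)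

lemma P3step_measurable {g : ℝ → ℝ} (hg : Measurable g) : Measurable (P3step p g) := by
  unfold P3step
  refine Measurable.ite measurableSet_Iio ?_ (Measurable.ite measurableSet_Iio ?_ ?_) <;> fun_prop

lemma P3step_fixed (hp : ∀ t, 0 < p t) (hsum : p 0 + p 1 + p 2 = 1) {f : ℝ → ℝ}
    (hself : ∀ t, ∀ x ∈ Set.Ico (0 : ℝ) 1,
      f (P3beta p t + p t * x) = P3beta p (P3theta t) + p (P3theta t) * f x)
    {x : ℝ} (hx : x ∈ Set.Ico (0 : ℝ) 1) : P3step p f x = f x := by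
  have h0 := hp 0
  have h1 := hp 1
  have h2 := hp 2
  unfold P3step
  split_ifs with hx0 hx1
  · have h := hself 0 (x / p 0) ⟨div_nonneg hx.1 h0.le, (div_lt_one h0).2 hx0⟩
    rw [mul_div_cancel₀ _ h0.ne'] at h
    simpa [P3beta, P3theta] using h.symm
  · have h := hself 1 ((x - p 0) / p 1)
      ⟨div_nonneg (by linarith) h1.le, (div_lt_one h1).2 (by linarith)⟩
    rw [mul_div_cancel₀ _ h1.ne'] at h
    simpa [P3beta, P3theta] using h.symm
  · have h := hself 2 ((x - (p 0 + p 1)) / p 2)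
      ⟨div_nonneg (by linarith) h2.le, (div_lt_one h2).2 (by linarith [hx.2])⟩
    rw [mul_div_cancel₀ _ h2.ne'] at h
    simpa [P3beta, P3theta] using h.symm

lemma P3step_contracting (hp : ∀ t, 0 < p t) (hsum : p 0 + p 1 + p 2 = 1) {q : ℝ}
    (hq : ∀ t, p t ≤ q) {g h : ℝ → ℝ} {C : ℝ}
    (hgh : ∀ x ∈ Set.Ico (0 : ℝ) 1, |g x - h x| ≤ C) {x : ℝ} (hx : x ∈ Set.Ico (0 : ℝ) 1) :
    |P3step p g x - P3step p h x| ≤ q * C := by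
  have h0 := hp 0
  have h1 := hp 1
  have h2 := hp 2
  have key : ∀ t, ∀ y ∈ Set.Ico (0 : ℝ) 1, |p t * (g y - h y)| ≤ q * C := fun t y hy => by
    rw [abs_mul, abs_of_pos (hp t)]
    exact mul_le_mul (hq t) (hgh y hy) (abs_nonneg _) ((hp t).le.trans (hq t))
  unfold P3step
  split_ifs with hx0 hx1
  · convert key 0 (x / p 0) ⟨div_nonneg hx.1 h0.le, (div_lt_one h0).2 hx0⟩ using 2
    ring
  · convert key 2 ((x - p 0) / p 1)
      ⟨div_nonneg (by linarith) h1.le, (div_lt_one h1).2 (by linarith)⟩ using 2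
    ring
  · convert key 1 ((x - (p 0 + p 1)) / p 2)
      ⟨div_nonneg (by linarith) h2.le, (div_lt_one h2).2 (by linarith [hx.2])⟩ using 2
    ring

lemma P3step_tendsto (hp : ∀ t, p t ∈ Set.Ioo (0 : ℝ) 1) (hsum : p 0 + p 1 + p 2 = 1)
    {f : ℝ → ℝ} (hfix : ∀ x ∈ Set.Ico (0 : ℝ) 1, P3step p f x = f x)
    (hbound : ∀ x ∈ Set.Ico (0 : ℝ) 1, |f x| ≤ 1) {x : ℝ} (hx : x ∈ Set.Ico (0 : ℝ) 1) :
    Tendsto (fun n => (P3step p)^[n] 0 x) atTop (nhds (f x)) := by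
  obtain ⟨s, hs⟩ := Finite.exists_max p
  have hiter : ∀ n : ℕ, ∀ y ∈ Set.Ico (0 : ℝ) 1, |(P3step p)^[n] 0 y - f y| ≤ p s ^ n := by
    intro n
    induction n with
    | zero => intro y hy; simpa using hbound y hy
    | succ n ih =>
      intro y hy
      rw [Function.iterate_succ_apply', ← hfix y hy, pow_succ']
      exact P3step_contracting (fun t => (hp t).1) hsum hs ih hy
  rw [tendsto_iff_norm_sub_tendsto_zero]
  exact squeeze_zero (fun _ => norm_nonneg _) (fun n => hiter n x hx)
    (tendsto_pow_atTop_nhds_zero_of_lt_one (hp s).1.le (hp s).2)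

lemma P3_integrableOn (hp : ∀ t, p t ∈ Set.Ioo (0 : ℝ) 1) (hsum : p 0 + p 1 + p 2 = 1)
    {f : ℝ → ℝ} (hfix : ∀ x ∈ Set.Ico (0 : ℝ) 1, P3step p f x = f x)
    (hbound : ∀ x ∈ Set.Ico (0 : ℝ) 1, |f x| ≤ 1) : IntegrableOn f (Set.Ico 0 1) := by
  have hmeas : ∀ n : ℕ, Measurable ((P3step p)^[n] 0) := by
    intro n
    induction n with
    | zero => exact measurable_zero
    | succ n ih =>
      rw [Function.iterate_succ_apply']
      exact P3step_measurable ih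
  have hlim : ∀ᵐ x ∂volume.restrict (Set.Ico (0 : ℝ) 1),
      Tendsto (fun n => (P3step p)^[n] 0 x) atTop (nhds (f x)) :=
    (ae_restrict_iff' measurableSet_Ico).2 (ae_of_all _ fun x hx =>
      P3step_tendsto hp hsum hfix hbound hx)
  exact IntegrableOn.of_bound (by simp)
    (aestronglyMeasurable_of_tendsto_ae atTop (fun n => (hmeas n).aestronglyMeasurable) hlim) 1
    ((ae_restrict_iff' measurableSet_Ico).2 (ae_of_all _ hbound))

lemma P3_integral_cylinder (hp : ∀ t, 0 < p t) {f : ℝ → ℝ}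
    (hself : ∀ t, ∀ x ∈ Set.Ico (0 : ℝ) 1,
      f (P3beta p t + p t * x) = P3beta p (P3theta t) + p (P3theta t) * f x)
    (hint : IntervalIntegrable f volume 0 1) (t : Fin 3) :
    ∫ x in P3beta p t..P3beta p t + p t, f x =
      p t * (P3beta p (P3theta t) + p (P3theta t) * ∫ x in (0 : ℝ)..1, f x) := by
  have hsubst := intervalIntegral.integral_comp_add_mul (a := 0) (b := 1) f (hp t).ne' (P3beta p t)
  have hcongr : ∫ x in (0 : ℝ)..1, f (P3beta p t + p t * x) =
      ∫ x in (0 : ℝ)..1, (P3beta p (P3theta t) + p (P3theta t) * f x) := by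
    simp only [intervalIntegral.integral_of_le zero_le_one, integral_Ioc_eq_integral_Ioo]
    exact setIntegral_congr_fun measurableSet_Ioo fun x hx => hself t x (Set.Ioo_subset_Ico_self hx)
  rw [hcongr, intervalIntegral.integral_add (by simp) (hint.const_mul _)] at hsubst
  simp only [intervalIntegral.integral_const, intervalIntegral.integral_const_mul, sub_zero,
    one_mul, mul_zero, add_zero, mul_one, smul_eq_mul] at hsubst
  rw [hsubst, mul_inv_cancel_left₀ (hp t).ne']

end P3val

theorem stmt12 (p : Fin 3 → ℝ) (hp : ∀ t, p t ∈ Set.Ioo (0 : ℝ) 1)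
    (hsum : p 0 + p 1 + p 2 = 1)
    (f : ℝ → ℝ)
    (hf : ∀ i : ℕ → Fin 3, (¬ ∃ N, ∀ k ≥ N, i k = 2) →
      f (P3val p i) = P3val p (fun k => P3theta (i k)))
    (hrep : ∀ x ∈ Set.Ico (0 : ℝ) 1, ∃ i : ℕ → Fin 3,
      (¬ ∃ N, ∀ k ≥ N, i k = 2) ∧ P3val p i = x) :
    ∫ x in Set.Icc (0 : ℝ) 1, f x =
      (p 1 ^ 2 + p 0 * p 1 + p 0 * p 2) / (1 - p 0 ^ 2 - 2 * p 1 * p 2) := by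
  have hpos : ∀ t, 0 < p t := fun t => (hp t).1
  have h0 := hpos 0
  have h1 := hpos 1
  have h2 := hpos 2
  have hself : ∀ t, ∀ x ∈ Set.Ico (0 : ℝ) 1,
      f (P3beta p t + p t * x) = P3beta p (P3theta t) + p (P3theta t) * f x :=
    fun t x hx => P3_digit_map_self_similar hpos hsum hf hrep t hx
  have hbound : ∀ x ∈ Set.Ico (0 : ℝ) 1, |f x| ≤ 1 := by
    intro x hx
    obtain ⟨i, hi, rfl⟩ := hrep x hx
    have hmem := P3val_mem_Icc hpos hsum fun k => P3theta (i k)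
    rw [hf i hi, abs_of_nonneg hmem.1]
    exact hmem.2
  have hint : IntervalIntegrable f volume 0 1 :=
    (intervalIntegrable_iff_integrableOn_Ico_of_le zero_le_one).2
      (P3_integrableOn hp hsum (fun x hx => P3step_fixed hpos hsum hself hx) hbound)
  have hsub : ∀ a ∈ Set.Icc (0 : ℝ) 1, ∀ b ∈ Set.Icc (0 : ℝ) 1,
      IntervalIntegrable f volume a b := fun a ha b hb =>
    hint.mono_set (by
      rw [Set.uIcc_of_le (zero_le_one' ℝ)]
      exact Set.uIcc_subset_Icc ha hb)
  have hm0 : (0 : ℝ) ∈ Set.Icc (0 : ℝ) 1 := ⟨le_rfl, zero_le_one⟩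
  have hm1 : p 0 ∈ Set.Icc (0 : ℝ) 1 := ⟨h0.le, by linarith⟩
  have hm2 : p 0 + p 1 ∈ Set.Icc (0 : ℝ) 1 := ⟨by linarith, by linarith⟩
  have hm3 : p 0 + p 1 + p 2 ∈ Set.Icc (0 : ℝ) 1 := ⟨by linarith, by linarith⟩
  have c0 := P3_integral_cylinder hpos hself hint 0
  have c1 := P3_integral_cylinder hpos hself hint 1
  have c2 := P3_integral_cylinder hpos hself hint 2
  simp only [P3beta, P3theta, Matrix.cons_val, zero_add] at c0 c1 c2
  have hsplit := intervalIntegral.integral_add_adjacent_intervals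
    (hsub _ hm0 _ hm1) (hsub _ hm1 _ hm2)
  have hsplit' := intervalIntegral.integral_add_adjacent_intervals
    (hsub _ hm0 _ hm2) (hsub _ hm2 _ hm3)
  rw [← hsplit, c0, c1, c2, hsum] at hsplit'
  rw [integral_Icc_eq_integral_Ioc, ← intervalIntegral.integral_of_le zero_le_one, eq_div_iff]
  · linarith
  · have : (p 0 + p 1 + p 2) ^ 2 = 1 := by rw [hsum, one_pow]
    nlinarith [mul_pos h0 h1, mul_pos h0 h2, mul_pos h1 h1, mul_pos h2 h2]
end
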